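/- arXiv:1402.4056 — 2 statements merged into one kernel-verified Lean document; each statement's English description precedes it below -/
import Mathlib

section
/- Let R be a commutative ring and let M and N be R-modules. There is an R-linear equivalence from the second exterior power ⋀²(M × N) onto the product (⋀²M) × (⋀²N) × (M ⊗[R] N) which sends the wedge (x,y) ∧ (x',y') to the triple (x ∧ x', y ∧ y', x ⊗ y' − x' ⊗ y). -/
open TensorProduct

/-- The wedge `x ∧ y` of two elements of `M`, as an element of the second exterior power
`⋀[R]^2 M`. -/
noncomputable def wedge (R : Type*) {M : Type*} [CommRing R] [AddCommGroup M] [Module R M]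
    (x y : M) : ⋀[R]^2 M :=
  ⟨ExteriorAlgebra.ιMulti R 2 ![x, y], ExteriorAlgebra.ιMulti_range R 2 ⟨![x, y], rfl⟩⟩

section Wedge

variable {R M P : Type*} [CommRing R] [AddCommGroup M] [Module R M] [AddCommGroup P] [Module R P]

theorem wedge_eq_ιMulti (x y : M) : wedge R x y = exteriorPower.ιMulti R 2 ![x, y] := rfl

theorem update_pair_zero {α : Type*} (x y z : α) : Function.update ![x, y] 0 z = ![z, y] := by
  ext i
  fin_cases i <;> rfl

theorem update_pair_one {α : Type*} (x y z : α) : Function.update ![x, y] 1 z = ![x, z] := by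
  ext i
  fin_cases i <;> rfl

theorem wedge_self (x : M) : wedge R x x = 0 :=
  (exteriorPower.ιMulti R 2).map_eq_zero_of_eq ![x, x] (i := 0) (j := 1) rfl (by decide)

theorem wedge_add_left (x x' y : M) : wedge R (x + x') y = wedge R x y + wedge R x' y := by
  simpa only [wedge_eq_ιMulti, update_pair_zero] using
    (exteriorPower.ιMulti R 2).map_update_add ![x, y] 0 x x'

theorem wedge_add_right (x y y' : M) : wedge R x (y + y') = wedge R x y + wedge R x y' := by
  simpa only [wedge_eq_ιMulti, update_pair_one] using
    (exteriorPower.ιMulti R 2).map_update_add ![x, y] 1 y y'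

theorem wedge_smul_left (c : R) (x y : M) : wedge R (c • x) y = c • wedge R x y := by
  simpa only [wedge_eq_ιMulti, update_pair_zero] using
    (exteriorPower.ιMulti R 2).map_update_smul ![x, y] 0 c x

theorem wedge_smul_right (c : R) (x y : M) : wedge R x (c • y) = c • wedge R x y := by
  simpa only [wedge_eq_ιMulti, update_pair_one] using
    (exteriorPower.ιMulti R 2).map_update_smul ![x, y] 1 c y

theorem wedge_swap (x y : M) : wedge R y x = -wedge R x y := by
  have h := wedge_self (R := R) (x + y)
  rw [wedge_add_left, wedge_add_right, wedge_add_right, wedge_self, wedge_self, zero_add,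
    add_zero] at h
  exact eq_neg_of_add_eq_zero_right h

variable (R M) in
/-- The wedge product as a bilinear map. -/
noncomputable def wedgeBilin : M →ₗ[R] M →ₗ[R] ⋀[R]^2 M :=
  LinearMap.mk₂ R (wedge R) wedge_add_left wedge_smul_left wedge_add_right
    fun c x y => wedge_smul_right c x y

@[simp]
theorem wedgeBilin_apply (x y : M) : wedgeBilin R M x y = wedge R x y := rfl

/-- An alternating bilinear map, as an alternating map on pairs. -/
def LinearMap.IsAlt.toAlternatingMap {B : M →ₗ[R] M →ₗ[R] P} (hB : B.IsAlt) :
    M [⋀^Fin 2]→ₗ[R] P where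
  toFun v := B (v 0) (v 1)
  map_update_add' {inst} v i x y := by
    cases Subsingleton.elim inst (instDecidableEqFin 2)
    fin_cases i <;> simp
  map_update_smul' {inst} v i c x := by
    cases Subsingleton.elim inst (instDecidableEqFin 2)
    fin_cases i <;> simp
  map_eq_zero_of_eq' v i j h hij := by
    have h01 : v 0 = v 1 := by
      fin_cases i <;> fin_cases j <;> first | exact absurd rfl hij | exact h | exact h.symm
    rw [h01]
    exact hB (v 1)

/-- The linear map out of the exterior square induced by an alternating bilinear map. -/
noncomputable def wedgeLift {B : M →ₗ[R] M →ₗ[R] P} (hB : B.IsAlt) : ⋀[R]^2 M →ₗ[R] P :=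
  exteriorPower.alternatingMapLinearEquiv hB.toAlternatingMap

@[simp]
theorem wedgeLift_wedge {B : M →ₗ[R] M →ₗ[R] P} (hB : B.IsAlt) (x y : M) :
    wedgeLift hB (wedge R x y) = B x y :=
  exteriorPower.alternatingMapLinearEquiv_apply_ιMulti _ _

@[simp]
theorem exteriorPower_map_wedge (f : M →ₗ[R] P) (x y : M) :
    exteriorPower.map 2 f (wedge R x y) = wedge R (f x) (f y) := by
  rw [wedge_eq_ιMulti, exteriorPower.map_apply_ιMulti, wedge_eq_ιMulti]
  congr 1
  ext i
  fin_cases i <;> rfl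

theorem exteriorSquare_hom_ext {f g : ⋀[R]^2 M →ₗ[R] P}
    (h : ∀ x y, f (wedge R x y) = g (wedge R x y)) : f = g := by
  refine exteriorPower.linearMap_ext (AlternatingMap.ext fun v => ?_)
  have hv : v = ![v 0, v 1] := by
    ext i
    fin_cases i <;> rfl
  rw [hv]
  exact h (v 0) (v 1)

end Wedge

section Prod

variable (R M N : Type*) [CommRing R] [AddCommGroup M] [Module R M] [AddCommGroup N] [Module R N]

/-- The bilinear map `((x, y), (x', y')) ↦ x ⊗ y' - x' ⊗ y` on `M × N`. -/
noncomputable def prodTensorBilin : (M × N) →ₗ[R] (M × N) →ₗ[R] M ⊗[R] N :=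
  let B := (TensorProduct.mk R M N).compl₁₂ (LinearMap.fst R M N) (LinearMap.snd R M N)
  B - B.flip

variable {M N} in
theorem prodTensorBilin_apply (p q : M × N) :
    prodTensorBilin R M N p q = p.1 ⊗ₜ[R] q.2 - q.1 ⊗ₜ[R] p.2 := rfl

theorem prodTensorBilin_isAlt : (prodTensorBilin R M N).IsAlt := fun p => by
  rw [prodTensorBilin_apply, sub_self]

/-- The map `(x, y) ∧ (x', y') ↦ (x ∧ x', y ∧ y', x ⊗ y' - x' ⊗ y)`. -/
noncomputable def exteriorSquareProdTo :
    ⋀[R]^2 (M × N) →ₗ[R] (⋀[R]^2 M) × (⋀[R]^2 N) × (M ⊗[R] N) :=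
  (exteriorPower.map 2 (LinearMap.fst R M N)).prod
    ((exteriorPower.map 2 (LinearMap.snd R M N)).prod (wedgeLift (prodTensorBilin_isAlt R M N)))

/-- The map out of the product induced by the inclusions of `M` and `N` into `M × N` and by
`x ⊗ y ↦ (x, 0) ∧ (0, y)`. -/
noncomputable def exteriorSquareProdFrom :
    (⋀[R]^2 M) × (⋀[R]^2 N) × (M ⊗[R] N) →ₗ[R] ⋀[R]^2 (M × N) :=
  (exteriorPower.map 2 (LinearMap.inl R M N)).coprod
    ((exteriorPower.map 2 (LinearMap.inr R M N)).coprod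
      (TensorProduct.lift
        ((wedgeBilin R (M × N)).compl₁₂ (LinearMap.inl R M N) (LinearMap.inr R M N))))

variable {M N} in
theorem exteriorSquareProdTo_wedge (p q : M × N) :
    exteriorSquareProdTo R M N (wedge R p q) =
      (wedge R p.1 q.1, wedge R p.2 q.2, p.1 ⊗ₜ[R] q.2 - q.1 ⊗ₜ[R] p.2) := by
  simp [exteriorSquareProdTo, prodTensorBilin_apply]

theorem exteriorSquareProdFrom_comp_to :
    exteriorSquareProdFrom R M N ∘ₗ exteriorSquareProdTo R M N = LinearMap.id := by
  refine exteriorSquare_hom_ext fun ⟨x, y⟩ ⟨x', y'⟩ => ?_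
  have hp : ((x, y) : M × N) = (x, 0) + (0, y) := by simp
  have hq : ((x', y') : M × N) = (x', 0) + (0, y') := by simp
  rw [LinearMap.comp_apply, exteriorSquareProdTo_wedge, LinearMap.id_apply, hp, hq,
    wedge_add_left, wedge_add_right, wedge_add_right, wedge_swap ((x', 0) : M × N) (0, y)]
  simp [exteriorSquareProdFrom]
  abel

theorem exteriorSquareProdTo_comp_from :
    exteriorSquareProdTo R M N ∘ₗ exteriorSquareProdFrom R M N = LinearMap.id := by
  refine LinearMap.prod_ext (exteriorSquare_hom_ext fun x x' => ?_)
    (LinearMap.prod_ext (exteriorSquare_hom_ext fun y y' => ?_) (TensorProduct.ext' fun x y => ?_))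
  · simp [exteriorSquareProdFrom, exteriorSquareProdTo_wedge, wedge_self]
  · simp [exteriorSquareProdFrom, exteriorSquareProdTo_wedge, wedge_self]
  · have hM : wedge R x 0 = 0 := (wedgeBilin R M x).map_zero
    have hN : wedge R 0 y = 0 := LinearMap.map_zero₂ (wedgeBilin R N) y
    simp [exteriorSquareProdFrom, exteriorSquareProdTo_wedge, hM, hN]

end Prod

/-- For `R`-modules `M` and `N`, there is an `R`-linear equivalence
`⋀²(M × N) ≃ (⋀²M) × (⋀²N) × (M ⊗[R] N)` sending `(x,y) ∧ (x',y')` to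
`(x ∧ x', y ∧ y', x ⊗ y' − x' ⊗ y)`. -/
theorem exteriorSquare_prod_decomposition (R : Type*) [CommRing R]
    (M N : Type*) [AddCommGroup M] [Module R M] [AddCommGroup N] [Module R N] :
    ∃ e : (⋀[R]^2 (M × N)) ≃ₗ[R] ((⋀[R]^2 M) × (⋀[R]^2 N) × (M ⊗[R] N)),
      ∀ (x x' : M) (y y' : N),
        e (wedge R (x, y) (x', y')) =
          (wedge R x x', wedge R y y', x ⊗ₜ[R] y' - x' ⊗ₜ[R] y) := by
  exact ⟨.ofLinearMap (exteriorSquareProdTo R M N) (exteriorSquareProdFrom R M N)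
    (exteriorSquareProdTo_comp_from R M N) (exteriorSquareProdFrom_comp_to R M N),
    fun x x' y y' => exteriorSquareProdTo_wedge R (x, y) (x', y')⟩
end

section
/- Let p be a prime and m ≥ 1 an integer. Let R = ℤ_p[X]/(X^m − p), where ℤ_p is the ring of p-adic integers, and let π be the image of X in R. Then the quotient ring R/(π)^m is isomorphic as a ring to (ℤ/pℤ)[X]/(X^m). -/
/-- The ideal `(X^m − p)` of `ℤ_p[X]`. -/
noncomputable abbrev eisensteinIdeal (p : ℕ) [Fact p.Prime] (m : ℕ) :
    Ideal (Polynomial ℤ_[p]) :=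
  Ideal.span {Polynomial.X ^ m - Polynomial.C (p : ℤ_[p])}

/-- The ring `R = ℤ_p[X]/(X^m − p)`. -/
noncomputable abbrev eisensteinQuot (p : ℕ) [Fact p.Prime] (m : ℕ) :=
  Polynomial ℤ_[p] ⧸ eisensteinIdeal p m

/-- The image `π` of `X` in `R = ℤ_p[X]/(X^m − p)`. -/
noncomputable abbrev eisensteinUniformizer (p : ℕ) [Fact p.Prime] (m : ℕ) :
    eisensteinQuot p m :=
  Ideal.Quotient.mk (eisensteinIdeal p m) Polynomial.X

/-- The preimage of `(X^m)` under reduction `ℤ_p[X] → (ℤ/pℤ)[X]` is `(X^m − p) + (X^m)`. -/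
theorem comap_mapRingHom_toZMod_span_X_pow (p : ℕ) [Fact p.Prime] (m : ℕ) :
    (Ideal.span {(Polynomial.X : Polynomial (ZMod p)) ^ m}).comap
        (Polynomial.mapRingHom (PadicInt.toZMod (p := p))) =
      eisensteinIdeal p m ⊔ Ideal.span {(Polynomial.X : Polynomial ℤ_[p]) ^ m} := by
  have hsurj : Function.Surjective (Polynomial.mapRingHom (PadicInt.toZMod (p := p))) :=
    Polynomial.map_surjective _ (ZMod.ringHom_surjective _)
  have hmap : Ideal.span {(Polynomial.X : Polynomial (ZMod p)) ^ m} =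
      (Ideal.span {(Polynomial.X : Polynomial ℤ_[p]) ^ m}).map
        (Polynomial.mapRingHom (PadicInt.toZMod (p := p))) := by
    simp [Ideal.map_span]
  rw [hmap, Ideal.comap_map_of_surjective _ hsurj, ← RingHom.ker_eq_comap_bot,
    Polynomial.ker_mapRingHom, PadicInt.ker_toZMod, PadicInt.maximalIdeal_eq_span_p,
    Ideal.map_span, Set.image_singleton]
  apply le_antisymm <;> refine sup_le ?_ ?_ <;>
    rw [Ideal.span_singleton_le_iff_mem, ← Ideal.span_union, Set.singleton_union,
      Ideal.mem_span_pair]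
  · exact ⟨0, 1, by ring⟩
  · exact ⟨-1, 1, by ring⟩
  · exact ⟨1, -1, by ring⟩
  · exact ⟨1, 0, by ring⟩

/-- For a prime `p` and `m ≥ 1`, with `R = ℤ_p[X]/(X^m − p)` and `π` the image of `X`, the
quotient ring `R/(π)^m` is isomorphic as a ring to `(ℤ/pℤ)[X]/(X^m)`. -/
theorem eisensteinQuot_mod_pow_uniformizer (p : ℕ) [Fact p.Prime] (m : ℕ) (hm : 1 ≤ m) :
    Nonempty ((eisensteinQuot p m ⧸ (Ideal.span {eisensteinUniformizer p m}) ^ m) ≃+*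
      (Polynomial (ZMod p) ⧸
        Ideal.span {(Polynomial.X : Polynomial (ZMod p)) ^ m})) := by
  have hpow : (Ideal.span {eisensteinUniformizer p m}) ^ m =
      (Ideal.span {(Polynomial.X : Polynomial ℤ_[p]) ^ m}).map
        (Ideal.Quotient.mk (eisensteinIdeal p m)) := by
    rw [Ideal.span_singleton_pow, Ideal.map_span, Set.image_singleton, map_pow]
  let φ := (Ideal.Quotient.mk (Ideal.span {(Polynomial.X : Polynomial (ZMod p)) ^ m})).comp
    (Polynomial.mapRingHom (PadicInt.toZMod (p := p)))
  have hφ : Function.Surjective φ :=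
    Ideal.Quotient.mk_surjective.comp
      (Polynomial.map_surjective _ (ZMod.ringHom_surjective _))
  have hker : eisensteinIdeal p m ⊔ Ideal.span {(Polynomial.X : Polynomial ℤ_[p]) ^ m} =
      RingHom.ker φ := by
    rw [← comap_mapRingHom_toZMod_span_X_pow, ← RingHom.comap_ker, Ideal.mk_ker]
  exact ⟨(Ideal.quotEquivOfEq hpow).trans <| (DoubleQuot.quotQuotEquivQuotSup _ _).trans <|
    (Ideal.quotEquivOfEq hker).trans <| RingHom.quotientKerEquivOfSurjective hφ⟩
end
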